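/- Let p ≥ 1 and l ≥ 1 be natural numbers, and let A = (A₁,...,A_p) be a p-tuple of symmetric ∞×∞ complex matrices (elements of Sym²-type matrices indexed by ℕ×ℕ) whose tuple rank is at least p·2^p·l. Then the projection of the orbit { (gA₁gᵀ,...,gA_pgᵀ) : g ∈ GL_∞(ℂ) } to the space of p-tuples of symmetric l×l matrices (taking upper-left l×l blocks) is Zariski-dense. -/

import Mathlib

open Matrix

section Perturbation

variable {K V W : Type*} [Field K] [AddCommGroup V] [Module K V] [AddCommGroup W] [Module K W]

/-- Linear independence of a finite family survives a perturbation `x + t • y` for all but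
finitely many scalars `t`. -/
theorem LinearIndependent.finite_setOf_not_add_smul {ι : Type*} [Fintype ι]
    {x : ι → W} (hx : LinearIndependent K x) (y : ι → W) :
    {t : K | ¬ LinearIndependent K (x + t • y)}.Finite := by
  classical
  obtain ⟨φ, hφ⟩ := (Fintype.linearCombination K x).exists_leftInverse_of_injective
    (LinearMap.ker_eq_bot.2 (hx.fintypeLinearCombination_injective))
  have hφx : ∀ i, φ (x i) = Pi.single i 1 := fun i => by
    simpa using LinearMap.congr_fun hφ (Pi.single i 1)
  let M : Matrix ι ι K := Matrix.of fun i => φ (y i)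
  let P : Polynomial K := (1 + (Polynomial.X : Polynomial K) • M.map Polynomial.C).det
  have hP : ∀ t, P.eval t = (1 + t • M).det := fun t => by
    have := RingHom.map_det (Polynomial.evalRingHom t)
      (1 + (Polynomial.X : Polynomial K) • M.map Polynomial.C)
    rw [Polynomial.coe_evalRingHom] at this
    rw [this]
    congr 1
    ext i j
    by_cases hij : i = j <;> simp [hij, mul_comm t]
  have hP0 : P ≠ 0 := fun h => by
    have := hP 0
    simp [h] at this
  refine (Polynomial.finite_setOfPred_isRoot hP0).subset fun t ht => ?_
  by_contra hroot
  apply ht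
  have hdet : (1 + t • M).det ≠ 0 := by rwa [← hP t]
  apply LinearIndependent.of_comp φ
  have hrows : φ ∘ (x + t • y) = (1 + t • M).row := by
    ext i j
    simp [hφx, M, Matrix.one_apply, Pi.single_apply, eq_comm]
  rw [hrows]
  exact Matrix.linearIndependent_rows_of_det_ne_zero hdet

/-- If every nontrivial combination of `m` linear maps has rank at least `m`, then the maps take
linearly independent values at some vector. -/
theorem exists_linearIndependent_apply [Infinite K] {m : ℕ} (T : Fin m → V →ₗ[K] W)
    (hT : ∀ c : Fin m → K, c ≠ 0 → ∀ k < m, ∀ w : Fin k → W,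
      ∃ v, ∑ i, c i • T i v ∉ Submodule.span K (Set.range w)) :
    ∃ u, LinearIndependent K fun i => T i u := by
  induction m with
  | zero => exact ⟨0, linearIndependent_empty_type⟩
  | succ m ih =>
    obtain ⟨u, hu⟩ := ih (fun i => T i.castSucc) fun c hc k hk w => by
      have hc' : (Fin.snoc c 0 : Fin (m + 1) → K) ≠ 0 := fun h => hc <| funext fun i => by
        simpa using congrFun h i.castSucc
      simpa [Fin.sum_univ_castSucc] using hT _ hc' k (hk.trans m.lt_succ_self) w
    by_cases hlast : T (Fin.last m) u ∈ Submodule.span K (Set.range fun i => T (Fin.castSucc i) u)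
    swap
    · exact ⟨u, linearIndependent_finSucc'.2 ⟨hu, hlast⟩⟩
    obtain ⟨c, hc⟩ := (Submodule.mem_span_range_iff_exists_fun K).1 hlast
    have hc' : (Fin.snoc (-c) 1 : Fin (m + 1) → K) ≠ 0 := fun h => by
      simpa using congrFun h (Fin.last m)
    obtain ⟨v, hv⟩ := hT _ hc' m m.lt_succ_self fun i => T (Fin.castSucc i) u
    simp only [Fin.sum_univ_castSucc, Fin.snoc_castSucc, Fin.snoc_last, Pi.neg_apply, neg_smul,
      Finset.sum_neg_distrib, one_smul] at hv
    set z := -∑ i, c i • T (Fin.castSucc i) v + T (Fin.last m) v with hz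
    have hx := linearIndependent_finSnoc.2 ⟨hu, hv⟩
    obtain ⟨t, ht⟩ := ((hx.finite_setOf_not_add_smul
      (Fin.snoc (fun i => T (Fin.castSucc i) v) 0 : Fin (m + 1) → W)).union
        (Set.finite_singleton (0 : K))).exists_notMem
    simp only [Set.mem_union, Set.mem_ofPred_eq, Set.mem_singleton_iff, not_or, not_not] at ht
    obtain ⟨hind, ht0⟩ := ht
    rw [linearIndependent_finSucc'] at hind
    have hrestrict : Fin.init ((Fin.snoc (fun i => T (Fin.castSucc i) u) z : Fin (m + 1) → W) +
        t • (Fin.snoc (fun i => T (Fin.castSucc i) v) 0 : Fin (m + 1) → W)) =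
        fun i => T (Fin.castSucc i) (u + t • v) := by
      ext i
      simp [Fin.init]
    rw [hrestrict] at hind
    refine ⟨u + t • v, linearIndependent_finSucc'.2 ⟨hind.1, fun hmem => hind.2 ?_⟩⟩
    have hzeq : z = t⁻¹ • (T (Fin.last m) (u + t • v) -
        ∑ i, c i • T (Fin.castSucc i) (u + t • v)) := by
      rw [eq_inv_smul_iff₀ ht0, hz]
      simp only [map_add, map_smul, smul_add, Finset.sum_add_distrib, hc, Finset.smul_sum,
        smul_neg, smul_comm t]
      abel
    simp only [Pi.add_apply, Fin.snoc_last, Pi.smul_apply, smul_zero, add_zero]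
    rw [hzeq]
    refine Submodule.smul_mem _ _ (Submodule.sub_mem _ hmem (Submodule.sum_mem _ fun i _ =>
      Submodule.smul_mem _ _ (Submodule.subset_span ⟨i, rfl⟩)))

/-- Finitely many linearly independent functionals can be prescribed arbitrary values. -/
theorem LinearIndependent.exists_forall_dual_apply_eq {ι : Type*} [Fintype ι]
    {φ : ι → Module.Dual K V} (hφ : LinearIndependent K φ) (c : ι → K) :
    ∃ v, ∀ i, φ i v = c i := by
  classical
  have hsurj : LinearMap.range (LinearMap.pi φ) = ⊤ := by
    by_contra hne
    obtain ⟨f, hf0, hf⟩ := Submodule.exists_le_ker_of_lt_top _ (lt_top_iff_ne_top.2 hne)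
    apply hf0
    have hsum : ∑ i, f (Pi.single i 1) • φ i = 0 := by
      ext v
      have hv : f (LinearMap.pi φ v) = 0 := hf ⟨v, rfl⟩
      rw [← Finset.univ_sum_single (LinearMap.pi φ v), map_sum] at hv
      rw [LinearMap.zero_apply, ← hv, LinearMap.sum_apply]
      refine Finset.sum_congr rfl fun i _ => ?_
      rw [← mul_one (LinearMap.pi φ v i), ← smul_eq_mul, Pi.single_smul', map_smul]
      simp [mul_comm]
    ext i
    simpa using Fintype.linearIndependent_iff.1 hφ _ hsum i
  obtain ⟨v, hv⟩ := LinearMap.range_eq_top.1 hsurj c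
  exact ⟨v, fun i => congrFun hv i⟩

end Perturbation

namespace MvPolynomial

variable {K σ : Type*} [Field K]

theorem eval_aeval_polynomial (F : σ → Polynomial K) (f : MvPolynomial σ K) (t : K) :
    (aeval F f).eval t = eval (fun q => (F q).eval t) f := by
  induction f using MvPolynomial.induction_on with
  | C a => simp [Polynomial.algebraMap_eq]
  | add f g hf hg => simp [hf, hg]
  | mul_X f q hf => simp [hf]

theorem derivative_aeval_polynomial [Fintype σ] (F : σ → Polynomial K) (f : MvPolynomial σ K) :
    Polynomial.derivative (aeval F f) =
      ∑ q, aeval F (pderiv q f) * Polynomial.derivative (F q) := by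
  classical
  induction f using MvPolynomial.induction_on with
  | C a => simp [Polynomial.algebraMap_eq]
  | add f g hf hg => simp [hf, hg, add_mul, Finset.sum_add_distrib]
  | mul_X f q hf =>
    rw [map_mul, aeval_X, Polynomial.derivative_mul, hf]
    simp only [pderiv_mul, pderiv_X, map_add, map_mul, aeval_X, add_mul, Finset.sum_add_distrib]
    congr 1
    · rw [Finset.sum_mul]
      exact Finset.sum_congr rfl fun _ _ => mul_right_comm _ _ _
    · rw [Finset.sum_eq_single q]
      · simp
      · intro b _ hb
        simp [Pi.single_eq_of_ne' hb]
      · simp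

/-- A polynomial vanishing at all but finitely many points of a polynomial curve vanishes on the
whole curve. -/
theorem aeval_polynomial_eq_zero_of_finite [Infinite K] {F : σ → Polynomial K}
    {f : MvPolynomial σ K} (h : {t | eval (fun q => (F q).eval t) f ≠ 0}.Finite) :
    aeval F f = 0 := by
  refine Polynomial.eq_zero_of_infinite_isRoot _ ?_
  refine h.infinite_compl.mono fun t ht => ?_
  simpa [Polynomial.IsRoot, eval_aeval_polynomial] using ht

theorem totalDegree_pderiv_le_pred (q : σ) (f : MvPolynomial σ K) :
    (pderiv q f).totalDegree ≤ f.totalDegree - 1 := by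
  refine Finset.sup_le fun s hs => ?_
  rw [mem_support_iff, coeff_pderiv] at hs
  have hle := le_totalDegree (mem_support_iff.2 (left_ne_zero_of_mul hs))
  rw [Finsupp.sum_add_index' (fun _ => rfl) (fun _ _ _ => rfl), Finsupp.sum_single_index rfl] at hle
  omega

/-- The derivative of a polynomial in the constant direction `C`. -/
noncomputable def directionalDerivative [Fintype σ] (C : σ → K) (f : MvPolynomial σ K) :
    MvPolynomial σ K :=
  ∑ q, C q • pderiv q f

theorem totalDegree_directionalDerivative_le [Fintype σ] (C : σ → K) (f : MvPolynomial σ K) :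
    (directionalDerivative C f).totalDegree ≤ f.totalDegree - 1 :=
  (totalDegree_finsetSum _ _).trans <| Finset.sup_le fun q _ =>
    (totalDegree_smul_le _ _).trans (totalDegree_pderiv_le_pred q f)

theorem eval_directionalDerivative [Fintype σ] (C x : σ → K) (f : MvPolynomial σ K) :
    eval x (directionalDerivative C f) = ∑ q, eval x (pderiv q f) * C q := by
  simp [directionalDerivative, smul_eval, mul_comm]

end MvPolynomial

section Congruence

open MvPolynomial

variable {K V : Type*} [Field K] [AddCommGroup V] [Module K V] {p l : ℕ}

/-- The Gram matrices of the vectors `P` under the bilinear forms `β`. -/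
def gramTuple (β : Fin p → V →ₗ[K] V →ₗ[K] K) (P : Fin l → V) (q : Fin p × Fin l × Fin l) : K :=
  β q.1 (P q.2.1) (P q.2.2)

/-- The Gram matrices along the line `P + t X`, as polynomials in `t`. -/
noncomputable def gramLine (β : Fin p → V →ₗ[K] V →ₗ[K] K) (P X : Fin l → V)
    (q : Fin p × Fin l × Fin l) : Polynomial K :=
  .C (β q.1 (P q.2.1) (P q.2.2)) +
    .C (β q.1 (P q.2.1) (X q.2.2) + β q.1 (X q.2.1) (P q.2.2)) * .X +
    .C (β q.1 (X q.2.1) (X q.2.2)) * .X ^ 2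

theorem eval_gramLine (β : Fin p → V →ₗ[K] V →ₗ[K] K) (P X : Fin l → V)
    (q : Fin p × Fin l × Fin l) (t : K) :
    (gramLine β P X q).eval t = gramTuple β (P + t • X) q := by
  simp [gramLine, gramTuple]
  ring

variable [CharZero K]

/-- If the functionals `β i (P a)` are independent, then a polynomial vanishing on all Gram tuples
has vanishing derivatives at `P` in all symmetric directions. -/
theorem eval_directionalDerivative_gramTuple {β : Fin p → V →ₗ[K] V →ₗ[K] K}
    (hβ : ∀ i x y, β i x y = β i y x) {f : MvPolynomial (Fin p × Fin l × Fin l) K}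
    (hf : ∀ P : Fin l → V, eval (gramTuple β P) f = 0) {P : Fin l → V}
    (hP : LinearIndependent K fun q : Fin p × Fin l => β q.1 (P q.2))
    {C : Fin p × Fin l × Fin l → K} (hC : ∀ i a b, C (i, a, b) = C (i, b, a)) :
    eval (gramTuple β P) (directionalDerivative C f) = 0 := by
  have hX : ∀ b, ∃ x, ∀ q : Fin p × Fin l, β q.1 (P q.2) x = C (q.1, q.2, b) / 2 := fun b =>
    hP.exists_forall_dual_apply_eq _
  choose X hX using hX
  have hcurve : aeval (gramLine β P X) f = 0 := aeval_polynomial_eq_zero_of_finite <| by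
    simp [eval_gramLine, hf]
  have hder := congrArg (fun g => (Polynomial.derivative g).eval 0) hcurve
  simp only [derivative_aeval_polynomial, Polynomial.eval_finsetSum, Polynomial.eval_mul,
    eval_aeval_polynomial, eval_gramLine, zero_smul, add_zero, Polynomial.derivative_zero,
    Polynomial.eval_zero] at hder
  rw [eval_directionalDerivative, ← hder]
  refine Finset.sum_congr rfl fun ⟨i, a, b⟩ _ => ?_
  have h1 := hX b (i, a)
  have h2 := hX a (i, b)
  rw [hβ] at h2
  simp only at h1 h2
  rw [hC i b a] at h2
  simp [gramLine, h1, h2]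

/-- If the functionals `β i (U a)` are independent for one tuple `U`, then the Gram tuples are
Zariski-dense in the tuples of symmetric matrices. -/
theorem eval_eq_zero_of_forall_gramTuple {β : Fin p → V →ₗ[K] V →ₗ[K] K}
    (hβ : ∀ i x y, β i x y = β i y x) {U : Fin l → V}
    (hU : LinearIndependent K fun q : Fin p × Fin l => β q.1 (U q.2))
    (f : MvPolynomial (Fin p × Fin l × Fin l) K)
    (hf : ∀ P : Fin l → V, eval (gramTuple β P) f = 0)
    {B : Fin p × Fin l × Fin l → K} (hB : ∀ i a b, B (i, a, b) = B (i, b, a)) :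
    eval B f = 0 := by
  induction hd : f.totalDegree using Nat.strong_induction_on generalizing f B with
  | _ d ih =>
  have h0 : eval 0 f = 0 := by
    have := hf 0
    rwa [show gramTuple β (0 : Fin l → V) = 0 by ext q; simp [gramTuple]] at this
  rcases Nat.eq_zero_or_pos d with rfl | hpos
  · rw [totalDegree_eq_zero_iff_eq_C.1 hd] at h0 ⊢
    simpa using h0
  have hD : ∀ P : Fin l → V, eval (gramTuple β P) (directionalDerivative B f) = 0 := by
    intro P
    have hfin := hU.finite_setOf_not_add_smul fun q : Fin p × Fin l => β q.1 (P q.2)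
    have hcurve : aeval (gramLine β P U) (directionalDerivative B f) = 0 := by
      refine aeval_polynomial_eq_zero_of_finite <|
        ((hfin.image Inv.inv).union (Set.finite_singleton 0)).subset fun s hs => ?_
      by_contra hmem
      simp only [Set.mem_union, Set.mem_singleton_iff, not_or, Set.mem_image] at hmem
      obtain ⟨hs', hs0⟩ := hmem
      apply hs
      simp only [eval_gramLine]
      refine eval_directionalDerivative_gramTuple hβ hf ?_ hB
      have hind : LinearIndependent K ((fun q : Fin p × Fin l => β q.1 (U q.2)) +
          s⁻¹ • fun q : Fin p × Fin l => β q.1 (P q.2)) := by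
        by_contra hind
        exact hs' ⟨s⁻¹, hind, inv_inv s⟩
      convert hind.units_smul (fun _ => Units.mk0 s hs0) using 1
      ext q x
      simp [Units.smul_def, hs0, add_comm]
    simpa [eval_aeval_polynomial, eval_gramLine] using congrArg (Polynomial.eval 0) hcurve
  have hzero : ∀ t : K, eval (t • B) (directionalDerivative B f) = 0 := fun t =>
    ih _ ((totalDegree_directionalDerivative_le B f).trans_lt (by omega)) _ hD
      (fun i a b => congrArg (t * ·) (hB i a b)) rfl
  let F : Fin p × Fin l × Fin l → Polynomial K := fun q => .C (B q) * .X
  have hF : ∀ t, (fun q => (F q).eval t) = t • B := fun t => by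
    ext q
    simp [F, mul_comm t]
  have hconst : Polynomial.derivative (aeval F f) = 0 := by
    refine Polynomial.funext fun t => ?_
    rw [Polynomial.eval_zero, ← hzero t, eval_directionalDerivative, derivative_aeval_polynomial]
    simp only [Polynomial.eval_finsetSum, Polynomial.eval_mul, eval_aeval_polynomial, hF]
    simp [F]
  have hc := Polynomial.eq_C_of_derivative_eq_zero hconst
  have e0 := congrArg (Polynomial.eval 0) hc
  have e1 := congrArg (Polynomial.eval 1) hc
  rw [Polynomial.eval_C, eval_aeval_polynomial, hF] at e0 e1
  rw [one_smul] at e1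
  rw [zero_smul, h0] at e0
  rw [e1, ← e0]

end Congruence

section InfiniteMatrix

variable {K : Type*} [Field K]

/-- The bilinear form on finitely supported vectors given by an infinite matrix. -/
noncomputable def infiniteMatrixForm (M : ℕ → ℕ → K) : (ℕ →₀ K) →ₗ[K] (ℕ →₀ K) →ₗ[K] K :=
  Finsupp.linearCombination K fun a => Finsupp.linearCombination K (M a)

@[simp]
theorem infiniteMatrixForm_single (M : ℕ → ℕ → K) (a b : ℕ) (x y : K) :
    infiniteMatrixForm M (Finsupp.single a x) (Finsupp.single b y) = x * (y * M a b) := by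
  simp [infiniteMatrixForm]

theorem infiniteMatrixForm_comm {M : ℕ → ℕ → K} (hM : ∀ a b, M a b = M b a) (x y : ℕ →₀ K) :
    infiniteMatrixForm M x y = infiniteMatrixForm M y x := by
  have : infiniteMatrixForm M = (infiniteMatrixForm M).flip := by
    ext a b
    simp [hM a b]
  exact LinearMap.congr_fun (LinearMap.congr_fun this x) y

theorem infiniteMatrixForm_sum_single (M : ℕ → ℕ → K) {n : ℕ} (x y : Fin n → K) :
    infiniteMatrixForm M (∑ j : Fin n, Finsupp.single (j : ℕ) (x j))
        (∑ k : Fin n, Finsupp.single (k : ℕ) (y k)) =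
      ∑ j, ∑ k, x j * (y k * M j k) := by
  simp only [map_sum, LinearMap.sum_apply, infiniteMatrixForm_single]
  exact Finset.sum_comm

theorem Finsupp.eq_sum_fin_single {x : ℕ →₀ K} {n : ℕ} (hx : ∀ a, n ≤ a → x a = 0) :
    ∑ j : Fin n, Finsupp.single (j : ℕ) (x j) = x := by
  ext a
  rw [Finsupp.finsetSum_apply]
  by_cases ha : a < n
  · rw [Finset.sum_eq_single ⟨a, ha⟩]
    · simp
    · intro j _ hj
      exact Finsupp.single_eq_of_ne fun h => hj (Fin.ext h.symm)
    · simp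
  · rw [hx a (not_lt.1 ha)]
    refine Finset.sum_eq_zero fun j _ => Finsupp.single_eq_of_ne fun h => ha (h ▸ j.2)

/-- High tuple rank produces vectors `U a` for which all functionals `A i (U a)` are independent. -/
theorem exists_linearIndependent_infiniteMatrixForm [Infinite K] {p l N : ℕ} (hN : p * l ≤ N)
    (A : Fin p → ℕ → ℕ → K)
    (hrank : ∀ c : Fin p → K, c ≠ 0 → ∃ rows cols : Fin N → ℕ,
      IsUnit (Matrix.det (Matrix.of fun a b => ∑ i, c i * A i (rows a) (cols b)))) :
    ∃ U : Fin l → ℕ →₀ K,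
      LinearIndependent K fun q : Fin p × Fin l => infiniteMatrixForm (A q.1) (U q.2) := by
  let e : Fin p × Fin l ≃ Fin (p * l) := finProdFinEquiv
  let T : Fin (p * l) → (Fin l → ℕ →₀ K) →ₗ[K] Module.Dual K (ℕ →₀ K) := fun i =>
    infiniteMatrixForm (A (e.symm i).1) ∘ₗ LinearMap.proj (e.symm i).2
  obtain ⟨U, hU⟩ := exists_linearIndependent_apply T fun c hc k hk w => by
    obtain ⟨i₀, hi₀⟩ := Function.ne_iff.1 hc
    set a := (e.symm i₀).2 with ha
    obtain ⟨rows, cols, hdet⟩ := hrank (fun i => c (e (i, a))) fun h => hi₀ <| by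
      simpa [ha] using congrFun h (e.symm i₀).1
    by_contra! hmem
    let R : Fin N → Module.Dual K (ℕ →₀ K) := fun r =>
      ∑ i, c (e (i, a)) • infiniteMatrixForm (A i) (Finsupp.single (rows r) 1)
    have hR : LinearIndependent K R := by
      let ev : Module.Dual K (ℕ →₀ K) →ₗ[K] Fin N → K :=
        LinearMap.pi fun b => LinearMap.applyₗ (Finsupp.single (cols b) 1)
      apply LinearIndependent.of_comp ev
      have hrows : ev ∘ R = Matrix.row (Matrix.of fun r b => ∑ i, c (e (i, a)) *
          A i (rows r) (cols b)) := by
        ext r b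
        simp [ev, R]
      rw [hrows]
      exact Matrix.linearIndependent_rows_of_det_ne_zero hdet.ne_zero
    have hRmem : Set.range R ≤ Submodule.span K (Set.range w) := by
      rintro _ ⟨r, rfl⟩
      have hr := hmem (Pi.single a (Finsupp.single (rows r) 1))
      rw [← e.sum_comp, Fintype.sum_prod_type] at hr
      refine (congrArg (· ∈ Submodule.span K (Set.range w)) ?_).mpr hr
      refine Finset.sum_congr rfl fun i _ => ?_
      rw [Finset.sum_eq_single a]
      · simp [T]
      · intro b _ hb
        simp [T, Pi.single_eq_of_ne hb]
      · simp
    have hcard := finrank_span_eq_card hR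
    have := FiniteDimensional.span_of_finite K (Set.finite_range w)
    have hmono := Submodule.finrank_mono (Submodule.span_le.2 hRmem)
    have hle := finrank_range_le_card (R := K) w
    rw [Set.finrank] at hle
    simp only [Fintype.card_fin] at hcard hle
    omega
  refine ⟨U, ?_⟩
  have hcomp : (fun q : Fin p × Fin l => infiniteMatrixForm (A q.1) (U q.2)) =
      (fun i => T i U) ∘ e := by
    ext q
    simp [T]
  rw [hcomp]
  exact hU.comp e e.injective

end InfiniteMatrix

theorem MvPolynomial.eval_gramTuple_eq_zero_of_orbit {K : Type*} [Field K] [Infinite K] {p l : ℕ}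
    (A : Fin p → ℕ → ℕ → K) (f : MvPolynomial (Fin p × Fin l × Fin l) K)
    (hf : ∀ (n : ℕ) (hn : l ≤ n) (g : Matrix (Fin n) (Fin n) K), IsUnit g →
      eval (fun q : Fin p × Fin l × Fin l =>
        (g * (Matrix.of fun a b : Fin n => A q.1 (a : ℕ) (b : ℕ)) * gᵀ)
          (Fin.castLE hn q.2.1) (Fin.castLE hn q.2.2)) f = 0)
    (P : Fin l → ℕ →₀ K) :
    eval (gramTuple (fun i => infiniteMatrixForm (A i)) P) f = 0 := by
  obtain ⟨m, hm⟩ := (Finset.univ.biUnion fun a => (P a).support).bddAbove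
  obtain ⟨n, hn, hPn⟩ : ∃ n, l ≤ n ∧ ∀ a b, n ≤ b → P a b = 0 := by
    refine ⟨max l (m + 1), le_max_left _ _, fun a b hb => ?_⟩
    by_contra hne
    have := hm (Finset.mem_coe.2 (Finset.mem_biUnion.2
      ⟨a, Finset.mem_univ a, Finsupp.mem_support_iff.2 hne⟩))
    omega
  let g : Matrix (Fin n) (Fin n) K :=
    Matrix.of fun a j => if h : (a : ℕ) < l then P ⟨a, h⟩ j else 0
  let X : Fin l → ℕ →₀ K := fun a => Finsupp.single (a : ℕ) 1
  have hcurve : aeval (gramLine (fun i => infiniteMatrixForm (A i)) P X) f = 0 := by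
    refine aeval_polynomial_eq_zero_of_finite <|
      ((Polynomial.finite_setOfPred_isRoot (Matrix.charpoly_monic (-g)).ne_zero)).subset
        fun t ht => ?_
    by_contra hroot
    apply ht
    have hunit : IsUnit (g + t • 1) := by
      rw [Matrix.isUnit_iff_isUnit_det, isUnit_iff_ne_zero]
      contrapose! hroot
      rw [Set.mem_ofPred_eq, Polynomial.IsRoot, Matrix.eval_charpoly, ← hroot]
      congr 1
      rw [sub_neg_eq_add, add_comm, Matrix.smul_one_eq_diagonal, Matrix.scalar_apply]
    rw [← hf n hn _ hunit]
    congr 2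
    ext q
    have hrow : ∀ a : Fin l, (P + t • X) a =
        ∑ j : Fin n, Finsupp.single (j : ℕ) ((g + t • 1) (Fin.castLE hn a) j) := by
      intro a
      have hX : ∀ b, n ≤ b → X a b = 0 := fun b hb =>
        Finsupp.single_eq_of_ne (by omega)
      rw [← Finsupp.eq_sum_fin_single (x := (P + t • X) a) (n := n) fun b hb => by
        simp [hPn a b hb, hX b hb]]
      refine Finset.sum_congr rfl fun j _ => congrArg _ ?_
      simp [g, X, Finsupp.single_apply, Matrix.one_apply, Fin.ext_iff]
    simp only [eval_gramLine, gramTuple]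
    rw [hrow, hrow, infiniteMatrixForm_sum_single]
    simp only [Matrix.mul_apply, Finset.sum_mul, Matrix.transpose_apply, Matrix.of_apply]
    rw [Finset.sum_comm]
    exact Finset.sum_congr rfl fun _ _ => Finset.sum_congr rfl fun _ _ => by ring
  simpa [eval_aeval_polynomial, eval_gramLine] using congrArg (Polynomial.eval 0) hcurve

/-- Lemma 7 of the paper.  Let `A = (A₁,...,A_p)` be a tuple of symmetric
`∞ × ∞` complex matrices (families `(m_{ij})_{i,j ∈ ℕ}`) whose tuple rank is
at least `p·2^p·l`; the rank condition is expressed by saying that every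
nonzero linear combination `∑ λᵢAᵢ` admits an invertible square submatrix of
size `p·2^p·l`.  Then the projection of the `GL_∞`-congruence orbit of `A` to
`p`-tuples of symmetric `l × l` matrices (upper-left `l × l` blocks) is
Zariski-dense: every polynomial vanishing on the projection of the orbit
vanishes on every `p`-tuple of symmetric `l × l` matrices.  An element of
`GL_∞` is represented by an invertible `n × n` matrix `g` for some `n ≥ l`,
acting on the upper-left `n × n` blocks by `g · A = g A gᵀ` (and by the
identity elsewhere). -/
theorem symmetric_high_rank_orbit_projection_dense (p l : ℕ) (hp : 0 < p)
    (hl : 0 < l) (A : Fin p → (ℕ → ℕ → ℂ))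
    (hsymm : ∀ i a b, A i a b = A i b a)
    (hrank : ∀ lam : Fin p → ℂ, lam ≠ 0 →
      ∃ rows cols : Fin (p * 2 ^ p * l) → ℕ,
        Function.Injective rows ∧ Function.Injective cols ∧
        IsUnit (Matrix.det
          (Matrix.of fun a b : Fin (p * 2 ^ p * l) =>
            ∑ i, lam i * A i (rows a) (cols b)))) :
    ∀ f : MvPolynomial (Fin p × Fin l × Fin l) ℂ,
      (∀ (n : ℕ) (hn : l ≤ n) (g : Matrix (Fin n) (Fin n) ℂ), IsUnit g →
        MvPolynomial.eval
          (fun q : Fin p × Fin l × Fin l =>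
            (g * (Matrix.of fun a b : Fin n => A q.1 (a : ℕ) (b : ℕ)) * gᵀ)
              (Fin.castLE hn q.2.1) (Fin.castLE hn q.2.2)) f = 0) →
      ∀ B : Fin p → Matrix (Fin l) (Fin l) ℂ, (∀ i, (B i).IsSymm) →
        MvPolynomial.eval
          (fun q : Fin p × Fin l × Fin l => B q.1 q.2.1 q.2.2) f = 0 := by
  intro f hf B hB
  have hN : p * l ≤ p * 2 ^ p * l :=
    Nat.mul_le_mul_right l (Nat.le_mul_of_pos_right p (Nat.two_pow_pos p))
  obtain ⟨U, hU⟩ := exists_linearIndependent_infiniteMatrixForm hN A fun c hc => by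
    obtain ⟨rows, cols, -, -, hdet⟩ := hrank c hc
    exact ⟨rows, cols, hdet⟩
  exact eval_eq_zero_of_forall_gramTuple (fun i => infiniteMatrixForm_comm (hsymm i)) hU f
    (MvPolynomial.eval_gramTuple_eq_zero_of_orbit A f hf) fun i a b => (hB i).apply b a
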